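/- arXiv:1912.08068 — 2 statements merged into one kernel-verified Lean document; each statement's English description precedes it below -/
import Mathlib

section
/- Let m ≥ 3 and let Q be a quadratic form on ℤ^m which is invariant under permutations and invariant under even sign changes. Then Q(e₀ − e₁) = 2 · Q(e₀); in particular, the value of Q on any vector e_i − e_j (i ≠ j) is even. -/
/-- The parallelogram law for quadratic maps. -/
theorem QuadraticMap.map_add_add_map_sub {M : Type*} [AddCommGroup M]
    (Q : QuadraticMap ℤ M ℤ) (x y : M) :
    Q (x + y) + Q (x - y) = 2 * Q x + 2 * Q y := by
  have h₁ := QuadraticMap.map_add Q x y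
  have h₂ := QuadraticMap.map_add Q x (-y)
  rw [QuadraticMap.map_neg, QuadraticMap.polar_neg_right, ← sub_eq_add_neg] at h₂
  linarith

/-- A permutation-invariant function takes the same value on all standard basis vectors. -/
theorem map_single_eq_of_perm_invariant {ι α : Type*} [DecidableEq ι] {f : (ι → ℤ) → α}
    (hperm : ∀ σ : Equiv.Perm ι, ∀ y : ι → ℤ, f (y ∘ σ) = f y) (i j : ι) :
    f (Pi.single i 1) = f (Pi.single j 1) := by
  rw [← hperm (Equiv.swap i j) (Pi.single i 1)]
  congr 1
  ext t
  simp only [Function.comp_apply, Pi.single_apply, Equiv.swap_apply_eq_iff,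
    Equiv.swap_apply_left]

/-- A function invariant under even sign changes takes the same value on `e_i - e_j` and
`e_i + e_j`, provided there is a third coordinate. -/
theorem map_single_sub_single_of_sign_invariant {ι α : Type*} [DecidableEq ι]
    {f : (ι → ℤ) → α}
    (hsign : ∀ i j : ι, i ≠ j → ∀ y : ι → ℤ,
      f (fun t => if t = i ∨ t = j then -y t else y t) = f y)
    {i j k : ι} (hij : i ≠ j) (hki : k ≠ i) (hkj : k ≠ j) :
    f (Pi.single i 1 - Pi.single j 1) = f (Pi.single i 1 + Pi.single j 1) := by
  rw [← hsign j k hkj.symm]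
  congr 1
  ext t
  simp only [Pi.sub_apply, Pi.add_apply, Pi.single_apply]
  grind

theorem map_single_sub_single_eq_two_mul {m : ℕ} (hm : 3 ≤ m)
    (Q : QuadraticMap ℤ (Fin m → ℤ) ℤ)
    (hperm : ∀ σ : Equiv.Perm (Fin m), ∀ y : Fin m → ℤ, Q (y ∘ σ) = Q y)
    (hsign : ∀ i j : Fin m, i ≠ j → ∀ y : Fin m → ℤ,
      Q (fun t => if t = i ∨ t = j then -y t else y t) = Q y)
    {i j : Fin m} (hij : i ≠ j) :
    Q (Pi.single i 1 - Pi.single j 1) = 2 * Q (Pi.single i 1) := by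
  obtain ⟨k, hki, hkj⟩ : ∃ k, k ≠ i ∧ k ≠ j :=
    Fin.exists_ne_and_ne_of_two_lt i j (by omega)
  have hsub := map_single_sub_single_of_sign_invariant hsign hij hki hkj
  have hlaw := Q.map_add_add_map_sub (Pi.single i 1) (Pi.single j 1)
  have heq := map_single_eq_of_perm_invariant hperm i j
  linarith

/-- For `m ≥ 3`, a quadratic form on `ℤ^m` invariant under permutations and under even
sign changes satisfies `Q(e₀ − e₁) = 2·Q(e₀)`; in particular its value on any vector
`e_i − e_j` with `i ≠ j` is even. -/
theorem even_value_on_short_coroot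
    {m : ℕ} (hm : 3 ≤ m) (Q : QuadraticMap ℤ (Fin m → ℤ) ℤ)
    (hperm : ∀ σ : Equiv.Perm (Fin m), ∀ y : Fin m → ℤ, Q (y ∘ σ) = Q y)
    (hsign : ∀ i j : Fin m, i ≠ j → ∀ y : Fin m → ℤ,
      Q (fun t => if t = i ∨ t = j then -y t else y t) = Q y) :
    Q (Pi.single (⟨0, by omega⟩ : Fin m) 1 - Pi.single (⟨1, by omega⟩ : Fin m) 1) =
      2 * Q (Pi.single (⟨0, by omega⟩ : Fin m) 1) ∧
    ∀ i j : Fin m, i ≠ j → 2 ∣ Q (Pi.single i 1 - Pi.single j 1) := by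
  have key {i j : Fin m} (hij : i ≠ j) :=
    map_single_sub_single_eq_two_mul hm Q hperm hsign hij
  exact ⟨key (by simp), fun i j hij => ⟨_, key hij⟩⟩
end

section
/- Let m ≥ 3 and let Q be a quadratic form on ℤ^m which is invariant under permutations and invariant under even sign changes. Then Q(y) = Q(e₀) · (∑ᵢ yᵢ²) for every y ∈ ℤ^m. In particular, such a quadratic form is uniquely determined by its value at a single standard basis vector. -/
/-- A quadratic map is additive on finite families whose members are pairwise orthogonal. -/
theorem QuadraticMap.map_sum_of_pairwise_polar_eq_zero {R M N ι : Type*} [CommRing R]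
    [AddCommGroup M] [AddCommGroup N] [Module R M] [Module R N]
    (Q : QuadraticMap R M N) (f : ι → M)
    (hf : Pairwise fun i j => QuadraticMap.polar Q (f i) (f j) = 0) (s : Finset ι) :
    Q (∑ i ∈ s, f i) = ∑ i ∈ s, Q (f i) := by
  classical
  induction s using Finset.induction_on with
  | empty => simp
  | insert a s ha ih =>
    have horth : QuadraticMap.polar Q (f a) (∑ i ∈ s, f i) = 0 := by
      rw [← QuadraticMap.polarBilin_apply_apply, map_sum]
      exact Finset.sum_eq_zero fun i hi => hf (ne_of_mem_of_not_mem hi ha).symm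
    rw [Finset.sum_insert ha, Finset.sum_insert ha, QuadraticMap.map_add Q, ih, horth, add_zero]

/-- Distinct standard basis vectors are orthogonal for a quadratic form that is invariant under
even sign changes in at least three variables. -/
theorem QuadraticMap.polar_single_single_eq_zero_of_even_sign_invariant
    {m : ℕ} (hm : 3 ≤ m) (Q : QuadraticMap ℤ (Fin m → ℤ) ℤ)
    (hsign : ∀ i j : Fin m, i ≠ j → ∀ y : Fin m → ℤ,
      Q (fun t => if t = i ∨ t = j then -y t else y t) = Q y)
    {i j : Fin m} (hij : i ≠ j) :
    QuadraticMap.polar Q (Pi.single i 1) (Pi.single j 1) = 0 := by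
  obtain ⟨k, hk⟩ : ∃ k, k ∉ ({i, j} : Finset (Fin m)) := by
    by_contra! h
    have hcard := Finset.card_le_two (a := i) (b := j)
    rw [Finset.eq_univ_iff_forall.mpr h, Finset.card_univ, Fintype.card_fin] at hcard
    omega
  simp only [Finset.mem_insert, Finset.mem_singleton, not_or] at hk
  have hflip := hsign i k (Ne.symm hk.1) (Pi.single i 1 + Pi.single j 1)
  have hvec : (fun t => if t = i ∨ t = k then -(Pi.single i 1 + Pi.single j 1 : Fin m → ℤ) t
      else (Pi.single i 1 + Pi.single j 1 : Fin m → ℤ) t) =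
      -Pi.single i 1 + Pi.single j 1 := by
    funext t
    simp only [Pi.add_apply, Pi.neg_apply, Pi.single_apply]
    grind
  rw [hvec, QuadraticMap.map_add Q, QuadraticMap.map_add Q, QuadraticMap.map_neg,
    QuadraticMap.polar_neg_left] at hflip
  linarith

/-- For `m ≥ 3`, a quadratic form on `ℤ^m` invariant under permutations and under even
sign changes satisfies `Q(y) = Q(e₀) · ∑ᵢ yᵢ²` for all `y`; in particular it is uniquely
determined by its value at a single standard basis vector. -/
theorem invariant_quadratic_form_eval
    {m : ℕ} (hm : 3 ≤ m) (Q : QuadraticMap ℤ (Fin m → ℤ) ℤ)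
    (hperm : ∀ σ : Equiv.Perm (Fin m), ∀ y : Fin m → ℤ, Q (y ∘ σ) = Q y)
    (hsign : ∀ i j : Fin m, i ≠ j → ∀ y : Fin m → ℤ,
      Q (fun t => if t = i ∨ t = j then -y t else y t) = Q y) :
    ∀ y : Fin m → ℤ,
      Q y = Q (Pi.single (⟨0, by omega⟩ : Fin m) 1) * ∑ i, (y i) ^ 2 := by
  intro y
  set o : Fin m := ⟨0, by omega⟩
  have hbasis (i : Fin m) : Q (Pi.single i 1) = Q (Pi.single o 1) := by
    rw [← hperm (Equiv.swap i o) (Pi.single o 1)]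
    congr 1
    funext t
    simp only [Function.comp_apply, Pi.single_apply, Equiv.swap_apply_def]
    grind
  have hy : y = ∑ i, y i • (Pi.single i 1 : Fin m → ℤ) := pi_eq_sum_univ' y
  have horth : Pairwise fun i j : Fin m =>
      QuadraticMap.polar Q (y i • Pi.single i 1) (y j • Pi.single j 1) = 0 := by
    intro i j hij
    rw [QuadraticMap.polar_smul_left, QuadraticMap.polar_smul_right,
      QuadraticMap.polar_single_single_eq_zero_of_even_sign_invariant hm Q hsign hij,
      smul_zero, smul_zero]
  conv_lhs => rw [hy]
  rw [QuadraticMap.map_sum_of_pairwise_polar_eq_zero Q _ horth, Finset.mul_sum]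
  refine Finset.sum_congr rfl fun i _ => ?_
  rw [QuadraticMap.map_smul, hbasis, smul_eq_mul]
  ring
end
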